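/- arXiv:1609.03710 — 3 statements merged into one kernel-verified Lean document; each statement's English description precedes it below -/
import Mathlib

section
/- Let G be a connected finite simple graph on the vertex set {1,…,n} with n ≥ 4, with exactly n edges, and containing three pairwise adjacent vertices (so that G has exactly one cycle, and this cycle has length 3). Then J_G is unmixed (all minimal primes of J_G in R have the same height) if and only if J_G is a set-theoretic complete intersection (ara(J_G) = ht(J_G)); and if these equivalent conditions hold, then ara(J_G) = ht(J_G) = n − 1. -/
open MvPolynomial

noncomputable section

/-- `f_{pq} = x_p · x_{n+q} − x_q · x_{n+p}` in `K[x_1,…,x_{2n}]`, where the first `n`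
variables are indexed by `Fin.castAdd n` and the last `n` variables by `Fin.natAdd n`. -/
def edgeBinomial (K : Type*) [Field K] (n : ℕ) (p q : Fin n) :
    MvPolynomial (Fin (n + n)) K :=
  X (Fin.castAdd n p) * X (Fin.natAdd n q) - X (Fin.castAdd n q) * X (Fin.natAdd n p)

/-- The binomial edge ideal `J_G` of a graph `G` on the vertex set `{1,…,n}`. -/
def binomialEdgeIdeal (K : Type*) [Field K] {n : ℕ} (G : SimpleGraph (Fin n)) :
    Ideal (MvPolynomial (Fin (n + n)) K) :=
  Ideal.span {f | ∃ p q : Fin n, p < q ∧ G.Adj p q ∧ f = edgeBinomial K n p q}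

/-- A binomial is a difference of two monomials. -/
def IsBinomial {K : Type*} [Field K] {m : ℕ} (f : MvPolynomial (Fin m) K) : Prop :=
  ∃ u v : Fin m →₀ ℕ, f = monomial u (1 : K) - monomial v 1

/-- The arithmetical rank: the smallest `s` such that there are `s` polynomials in `I`
generating `I` up to radical. -/
def ara {K : Type*} [Field K] {m : ℕ} (I : Ideal (MvPolynomial (Fin m) K)) : ℕ :=
  sInf {s | ∃ F : Fin s → MvPolynomial (Fin m) K,
    (∀ i, F i ∈ I) ∧ (Ideal.span (Set.range F)).radical = I.radical}

/-- The binomial arithmetical rank: the smallest `s` such that there are `s` binomials in `I`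
generating `I` up to radical. -/
def bar {K : Type*} [Field K] {m : ℕ} (I : Ideal (MvPolynomial (Fin m) K)) : ℕ :=
  sInf {s | ∃ B : Fin s → MvPolynomial (Fin m) K,
    (∀ i, IsBinomial (B i)) ∧ (∀ i, B i ∈ I) ∧
    (Ideal.span (Set.range B)).radical = I.radical}

/-- The height of an ideal: the infimum of the heights (in the prime spectrum) of the
prime ideals containing it. -/
def idealHeight {R : Type*} [CommRing R] (I : Ideal R) : ℕ∞ :=
  ⨅ (p : PrimeSpectrum R) (_ : I ≤ p.asIdeal), Order.height p

/-- An ideal is unmixed if all its minimal primes have the same height. -/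
def IsUnmixed {R : Type*} [CommRing R] (I : Ideal R) : Prop :=
  ∀ P ∈ I.minimalPrimes, ∀ Q ∈ I.minimalPrimes, idealHeight P = idealHeight Q

lemma idealHeight_eq_height {R : Type*} [CommRing R] (I : Ideal R) :
    idealHeight I = I.height := by
  unfold idealHeight
  apply le_antisymm
  · rw [Ideal.height_eq_inf_minimalPrimes]
    refine le_iInf₂ fun J hJ => ?_
    have hp := hJ.isPrime
    refine (iInf₂_le (⟨J, hp⟩ : PrimeSpectrum R) hJ.1.2).trans ?_
    rw [← PrimeSpectrum.height_eq_orderHeight]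
  · refine le_iInf₂ fun p hp => ?_
    rw [← PrimeSpectrum.height_eq_orderHeight]
    exact Ideal.height_mono hp

lemma height_le_of_radical {R : Type*} [CommRing R] [IsNoetherianRing R] {I P : Ideal R} {s : ℕ}
    (F : Fin s → R) (h : (Ideal.span (Set.range F)).radical = I.radical)
    (hP : P ∈ I.minimalPrimes) : P.height ≤ s := by
  classical
  rw [← Ideal.radical_minimalPrimes, ← h, Ideal.radical_minimalPrimes] at hP
  have e : Set.range F = ((Finset.univ.image F : Finset R) : Set R) := by simp
  rw [e] at hP
  refine (Ideal.height_le_card_of_mem_minimalPrimes_span_finset hP).trans ?_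
  have := Finset.card_image_le (s := (Finset.univ : Finset (Fin s))) (f := F)
  simp only [Finset.card_univ, Fintype.card_fin] at this
  exact_mod_cast this

/-- The partial parametrisation: `y_i ↦ y_z x_i` for `i < k`. -/
def phi (K : Type*) [Field K] {n : ℕ} (z : Fin n) (k : ℕ) :
    MvPolynomial (Fin (n + n)) K →ₐ[K] MvPolynomial (Fin (n + n)) K :=
  aeval (Fin.addCases (fun i => X (Fin.castAdd n i))
    (fun i => if i.val < k then X (Fin.natAdd n z) * X (Fin.castAdd n i) else X (Fin.natAdd n i)))

@[simp] lemma phi_cast (K : Type*) [Field K] {n : ℕ} (z : Fin n) (k : ℕ) (i : Fin n) :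
    phi K z k (X (Fin.castAdd n i)) = X (Fin.castAdd n i) := by
  simp [phi, -Fin.natAdd_eq_addNat]

@[simp] lemma phi_nat (K : Type*) [Field K] {n : ℕ} (z : Fin n) (k : ℕ) (i : Fin n) :
    phi K z k (X (Fin.natAdd n i)) =
      if i.val < k then X (Fin.natAdd n z) * X (Fin.castAdd n i) else X (Fin.natAdd n i) := by
  simp [phi, -Fin.natAdd_eq_addNat]

lemma phi_step (K : Type*) [Field K] {n : ℕ} (z : Fin n) (hz : z.val = 0) (k : ℕ) (hk : 1 ≤ k)
    (hkn : k < n) :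
    RingHom.ker (phi K z k) < RingHom.ker (phi K z (k + 1)) := by
  have hcomp : phi K z (k + 1) =
      (aeval (Fin.addCases (fun i => X (Fin.castAdd n i))
        (fun i => if i.val = k then X (Fin.natAdd n z) * X (Fin.castAdd n i)
          else X (Fin.natAdd n i))) :
        MvPolynomial (Fin (n + n)) K →ₐ[K] MvPolynomial (Fin (n + n)) K).comp (phi K z k) := by
    apply MvPolynomial.algHom_ext
    intro j
    refine Fin.addCases (fun i => ?_) (fun i => ?_) j
    · simp
    · rcases lt_trichotomy i.val k with h | h | h
      · have h1 : i.val < k + 1 := by omega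
        have h2 : (0 : ℕ) ≠ k := by omega
        simp [h, h1, hz, h2, -Fin.natAdd_eq_addNat]
      · simp [h, -Fin.natAdd_eq_addNat]
      · have h1 : ¬ i.val < k + 1 := by omega
        have h2 : ¬ i.val < k := by omega
        have h3 : i.val ≠ k := by omega
        simp [h1, h2, h3, -Fin.natAdd_eq_addNat]
  rw [SetLike.lt_iff_le_and_exists]
  obtain ⟨m, hmk⟩ : ∃ m : Fin n, m.val = k := ⟨⟨k, hkn⟩, rfl⟩
  refine ⟨?_, edgeBinomial K n z m, ?_, ?_⟩
  · intro g hg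
    rw [RingHom.mem_ker] at hg ⊢
    rw [hcomp, AlgHom.comp_apply, hg, map_zero]
  · rw [RingHom.mem_ker]
    simp [edgeBinomial, hz, hmk, -Fin.natAdd_eq_addNat]
    ring
  · rw [RingHom.mem_ker]
    intro h
    have h1 : z.val < k := by omega
    have := congrArg (aeval (Fin.addCases (fun i => if i = z then (1 : K) else 0)
        (fun i => if i.val = k then (1 : K) else 0))) h
    have h2 : m ≠ z := by
      rintro rfl; omega
    simp [edgeBinomial, h1, h2, hmk, -Fin.natAdd_eq_addNat] at this

lemma phi_height (K : Type*) [Field K] {n : ℕ} (z : Fin n) (hz : z.val = 0) (k : ℕ)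
    (hkn : k < n) : (k : ℕ∞) ≤ (RingHom.ker (phi K z (k + 1))).height := by
  induction k with
  | zero => simp
  | succ k ih =>
    have h := phi_step K z hz (k + 1) (by omega) hkn
    have p1 : (RingHom.ker (phi K z (k + 1))).IsPrime := RingHom.ker_isPrime _
    have p2 : (RingHom.ker (phi K z (k + 1 + 1))).IsPrime := RingHom.ker_isPrime _
    have := Ideal.height_add_one_le_of_lt_of_isPrime h
    refine le_trans ?_ this
    push_cast
    gcongr
    exact ih (by omega)

lemma edge_mem (K : Type*) [Field K] {n : ℕ} {G : SimpleGraph (Fin n)} {p q : Fin n}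
    (h : G.Adj p q) : edgeBinomial K n p q ∈ binomialEdgeIdeal K G := by
  rcases lt_or_gt_of_ne h.ne with hlt | hlt
  · exact Ideal.subset_span ⟨p, q, hlt, h, rfl⟩
  · have : edgeBinomial K n p q = - edgeBinomial K n q p := by
      simp only [edgeBinomial]; ring
    rw [this]
    exact neg_mem (Ideal.subset_span ⟨q, p, hlt, h.symm, rfl⟩)

lemma exists_minimal (K : Type*) [Field K] {n : ℕ} (hn : 0 < n) (G : SimpleGraph (Fin n))
    (hconn : G.Connected) :
    ∃ Q ∈ (binomialEdgeIdeal K G).minimalPrimes, ((n - 1 : ℕ) : ℕ∞) ≤ Q.height := by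
  set z : Fin n := ⟨0, hn⟩ with hz
  have hP : (RingHom.ker (phi K z n)).IsPrime := RingHom.ker_isPrime _
  have hle : binomialEdgeIdeal K G ≤ RingHom.ker (phi K z n) := by
    refine Ideal.span_le.mpr ?_
    rintro f ⟨p, q, -, -, rfl⟩
    simp only [SetLike.mem_coe, RingHom.mem_ker]
    simp [edgeBinomial, -Fin.natAdd_eq_addNat]
    ring
  obtain ⟨Q, hQ, hQP⟩ := Ideal.exists_minimalPrimes_le hle
  have hQp := hQ.isPrime
  refine ⟨Q, hQ, ?_⟩
  have hx : ∀ i, X (Fin.castAdd n i) ∉ Q := by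
    intro i hi
    have := hQP hi
    rw [RingHom.mem_ker] at this
    simp at this
  have hall : ∀ i, edgeBinomial K n z i ∈ Q := by
    intro i
    obtain ⟨w⟩ := hconn.preconnected i z
    clear_value z
    clear hQP hle hP hz
    induction w with
    | nil => simp [edgeBinomial]
    | @cons u v w h _ ih =>
      have h1 := ih
      have h2 : edgeBinomial K n u v ∈ Q := hQ.1.2 (edge_mem K h)
      refine (hQp.mem_or_mem (x := X (Fin.castAdd n v)) ?_).resolve_left (hx v)
      have : X (Fin.castAdd n v) * edgeBinomial K n w u =
          X (Fin.castAdd n u) * edgeBinomial K n w v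
            - X (Fin.castAdd n w) * edgeBinomial K n u v := by
        simp only [edgeBinomial]; ring
      rw [this]
      exact sub_mem (Q.mul_mem_left _ h1) (Q.mul_mem_left _ h2)
  have hker : RingHom.ker (phi K z n) ≤ Q := by
    let L := FractionRing (MvPolynomial (Fin (n + n)) K ⧸ Q)
    let π : MvPolynomial (Fin (n + n)) K →ₐ[K] L :=
      (IsScalarTower.toAlgHom K (MvPolynomial (Fin (n + n)) K ⧸ Q) L).comp (Ideal.Quotient.mkₐ K Q)
    have hπ : ∀ g, π g = 0 ↔ g ∈ Q := by
      intro g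
      simp [π, Ideal.Quotient.eq_zero_iff_mem]
    have hz0 : π (X (Fin.castAdd n z)) ≠ 0 := fun h => hx z ((hπ _).1 h)
    have hfac : π = (aeval (Fin.addCases (fun i => π (X (Fin.castAdd n i)))
        (fun _ => π (X (Fin.natAdd n z)) / π (X (Fin.castAdd n z)))) :
          MvPolynomial (Fin (n + n)) K →ₐ[K] L).comp (phi K z n) := by
      apply MvPolynomial.algHom_ext
      intro j
      refine Fin.addCases (fun i => ?_) (fun i => ?_) j
      · simp
      · have h := (hπ _).2 (hall i)
        simp only [edgeBinomial, map_sub, map_mul] at h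
        simp only [AlgHom.comp_apply, phi_nat, i.isLt, if_true, map_mul, aeval_X,
          Fin.addCases_left, Fin.addCases_right]
        rw [div_mul_eq_mul_div, eq_div_iff hz0]
        linear_combination h
    intro g hg
    rw [RingHom.mem_ker] at hg
    rw [← hπ, hfac, AlgHom.comp_apply, hg, map_zero]
  have := phi_height K z rfl (n - 1) (by omega)
  rw [Nat.sub_add_cancel hn] at this
  exact this.trans (Ideal.height_mono hker)

lemma exists_pendant {n : ℕ} (hn : 4 ≤ n) (G : SimpleGraph (Fin n)) (hconn : G.Connected)
    (htri : ∃ a b c : Fin n, G.Adj a b ∧ G.Adj b c ∧ G.Adj a c) :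
    ∃ a b c d : Fin n, G.Adj a b ∧ G.Adj b c ∧ G.Adj a c ∧ G.Adj a d ∧ d ≠ b ∧ d ≠ c := by
  obtain ⟨a, b, c, hab, hbc, hac⟩ := htri
  have : ∃ e : Fin n, e ∉ ({a, b, c} : Finset (Fin n)) := by
    by_contra! h
    have h1 : (Finset.univ : Finset (Fin n)) ⊆ {a, b, c} := fun x _ => h x
    have h2 := Finset.card_le_card h1
    have h3 := Finset.card_le_three (a := a) (b := b) (c := c)
    simp only [Finset.card_univ, Fintype.card_fin] at h2
    omega
  obtain ⟨e, he⟩ := this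
  obtain ⟨w⟩ := hconn.preconnected a e
  obtain ⟨⟨⟨u, d⟩, hadj⟩, -, h1, h2⟩ := w.exists_boundary_dart (({a, b, c} : Finset (Fin n)) : Set _)
    (by simp) (by simpa using he)
  simp only [Finset.coe_insert, Finset.coe_singleton, Set.mem_insert_iff, Set.mem_singleton_iff,
    not_or] at h1 h2
  obtain ⟨h2a, h2b, h2c⟩ := h2
  change G.Adj u d at hadj
  rcases h1 with rfl | rfl | rfl
  · exact ⟨_, b, c, d, hab, hbc, hac, hadj, h2b, h2c⟩
  · exact ⟨_, a, c, d, hab.symm, hac, hbc, hadj, h2a, h2c⟩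
  · exact ⟨_, a, b, d, hac.symm, hab, hbc.symm, hadj, h2a, h2b⟩

lemma exists_gens (K : Type*) [Field K] {n : ℕ} (hn : 4 ≤ n)
    (G : SimpleGraph (Fin n)) [DecidableRel G.Adj] (hconn : G.Connected)
    (hm : G.edgeFinset.card = n)
    (htri : ∃ a b c : Fin n, G.Adj a b ∧ G.Adj b c ∧ G.Adj a c) :
    ∃ F : Fin (n - 1) → MvPolynomial (Fin (n + n)) K,
      (∀ i, F i ∈ binomialEdgeIdeal K G) ∧
      (Ideal.span (Set.range F)).radical = (binomialEdgeIdeal K G).radical := by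
  obtain ⟨a, b, c, d, hab, hbc, hac, had, hdb, hdc⟩ := exists_pendant hn G hconn htri
  have hcard : (G.edgeFinset.erase s(b, c)).card = n - 1 := by
    rw [Finset.card_erase_of_mem (by simpa using hbc), hm]
  let eqv := (Finset.equivFinOfCardEq hcard).symm
  let f : Sym2 (Fin n) → MvPolynomial (Fin (n + n)) K := fun e => edgeBinomial K n e.inf e.sup
  let H : Sym2 (Fin n) → MvPolynomial (Fin (n + n)) K := fun e =>
    f e + if e = s(a, d) then f s(b, c) else 0
  have hsign : ∀ p q, f s(p, q) = edgeBinomial K n p q ∨ f s(p, q) = - edgeBinomial K n p q := by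
    intro p q
    rcases le_total p q with h | h
    · left; simp [f, h]
    · right; simp only [f, Sym2.inf_mk, Sym2.sup_mk, inf_eq_right.2 h, sup_eq_left.2 h]
      simp only [edgeBinomial]; ring
  have hsmem : ∀ (I : Ideal (MvPolynomial (Fin (n + n)) K)) (p q), f s(p, q) ∈ I ↔
      edgeBinomial K n p q ∈ I := by
    intro I p q
    rcases hsign p q with h | h <;> rw [h]
    exact neg_mem_iff
  have hfJ : ∀ p q, G.Adj p q → f s(p, q) ∈ binomialEdgeIdeal K G := fun p q h =>
    (hsmem _ p q).2 (edge_mem K h)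
  have hHJ : ∀ e ∈ G.edgeFinset, H e ∈ binomialEdgeIdeal K G := by
    intro e he
    simp only [H]
    refine add_mem ?_ ?_
    · induction e with
      | _ p q => exact hfJ p q (by simpa using he)
    · split_ifs
      · exact hfJ _ _ hbc
      · exact zero_mem _
  refine ⟨fun i => H (eqv i).1, fun i => hHJ _ (Finset.mem_of_mem_erase (eqv i).2), ?_⟩
  · set I := Ideal.span (Set.range fun i => H (eqv i).1) with hI
    have hH : ∀ p q, G.Adj p q → s(p, q) ≠ s(b, c) → H s(p, q) ∈ I.radical := by
      intro p q h hne
      apply Ideal.le_radical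
      apply Ideal.subset_span
      refine ⟨eqv.symm ⟨s(p, q), by simp [hne, h]⟩, by simp⟩
    have hf1 : ∀ p q, G.Adj p q → s(p, q) ≠ s(b, c) → s(p, q) ≠ s(a, d) →
        f s(p, q) ∈ I.radical := by
      intro p q h h1 h2
      have := hH p q h h1
      simpa [H, h2] using this
    have nab := hab.ne
    have nac := hac.ne
    have nbc := hbc.ne
    have fab : edgeBinomial K n a b ∈ I.radical := (hsmem _ _ _).1 (hf1 a b hab (by
      simp [nab, nac]) (by simp [hdb.symm, nab.symm]))
    have fac : edgeBinomial K n a c ∈ I.radical := (hsmem _ _ _).1 (hf1 a c hac (by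
      simp [nab, nac]) (by simp [hdc.symm, nac.symm]))
    have hsum : f s(a, d) + f s(b, c) ∈ I.radical := by
      have := hH a d had (by simp [nab, nac])
      simpa [H] using this
    have hprod : f s(a, d) * f s(b, c) ∈ I.radical := by
      have h1 : edgeBinomial K n a d * edgeBinomial K n b c ∈ I.radical := by
        have : edgeBinomial K n a d * edgeBinomial K n b c =
            edgeBinomial K n b d * edgeBinomial K n a c
            - edgeBinomial K n c d * edgeBinomial K n a b := by
          simp only [edgeBinomial]; ring
        rw [this]
        exact sub_mem (Ideal.mul_mem_left _ _ fac) (Ideal.mul_mem_left _ _ fab)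
      rcases hsign a d with h | h <;> rcases hsign b c with h' | h' <;> rw [h, h'] <;>
        simpa using h1
    have hrad : ∀ x, x ^ 2 ∈ I.radical → x ∈ I.radical := by
      intro x hx
      exact (Ideal.radical_isRadical I) ⟨2, hx⟩
    have fad : f s(a, d) ∈ I.radical := by
      apply hrad
      have : f s(a, d) ^ 2 = f s(a, d) * (f s(a, d) + f s(b, c)) - f s(a, d) * f s(b, c) := by ring
      rw [this]
      exact sub_mem (Ideal.mul_mem_left _ _ hsum) hprod
    have fbc : f s(b, c) ∈ I.radical := by
      have := sub_mem hsum fad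
      simpa using this
    apply le_antisymm
    · apply Ideal.radical_mono
      refine Ideal.span_le.mpr ?_
      rintro _ ⟨i, rfl⟩
      exact hHJ _ (Finset.mem_of_mem_erase (eqv i).2)
    · rw [Ideal.radical_le_radical_iff]
      refine Ideal.span_le.mpr ?_
      rintro _ ⟨p, q, -, h, rfl⟩
      refine (hsmem _ p q).1 ?_
      by_cases h1 : s(p, q) = s(b, c)
      · rw [h1]; exact fbc
      by_cases h2 : s(p, q) = s(a, d)
      · rw [h2]; exact fad
      exact hf1 p q h h1 h2

theorem stmt_12 (K : Type*) [Field K] (n : ℕ) (hn : 4 ≤ n)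
    (G : SimpleGraph (Fin n)) [DecidableRel G.Adj] (hconn : G.Connected)
    (hm : G.edgeFinset.card = n)
    (htri : ∃ a b c : Fin n, G.Adj a b ∧ G.Adj b c ∧ G.Adj a c) :
    (IsUnmixed (binomialEdgeIdeal K G) ↔
      (ara (binomialEdgeIdeal K G) : ℕ∞) = idealHeight (binomialEdgeIdeal K G)) ∧
    (IsUnmixed (binomialEdgeIdeal K G) →
      ara (binomialEdgeIdeal K G) = n - 1 ∧
      idealHeight (binomialEdgeIdeal K G) = ((n - 1 : ℕ) : ℕ∞)) := by
  obtain ⟨Q, hQ, hQh⟩ := exists_minimal K (by omega) G hconn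
  have hgens := exists_gens K hn G hconn hm htri
  have hle : ara (binomialEdgeIdeal K G) ≤ n - 1 := Nat.sInf_le hgens
  obtain ⟨F, hF, hFr⟩ : ara (binomialEdgeIdeal K G) ∈ {s | ∃ F : Fin s → MvPolynomial (Fin (n + n)) K,
    (∀ i, F i ∈ binomialEdgeIdeal K G) ∧
      (Ideal.span (Set.range F)).radical = (binomialEdgeIdeal K G).radical} :=
    Nat.sInf_mem ⟨_, hgens⟩
  have hub : ∀ P ∈ (binomialEdgeIdeal K G).minimalPrimes,
      P.height ≤ (ara (binomialEdgeIdeal K G) : ℕ∞) := fun P hP => height_le_of_radical F hFr hP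
  have hara : ara (binomialEdgeIdeal K G) = n - 1 :=
    le_antisymm hle (by exact_mod_cast hQh.trans (hub Q hQ))
  have hht : IsUnmixed (binomialEdgeIdeal K G) →
      idealHeight (binomialEdgeIdeal K G) = ((n - 1 : ℕ) : ℕ∞) := by
    intro hu
    rw [idealHeight_eq_height, Ideal.height_eq_inf_minimalPrimes]
    have hall : ∀ P ∈ (binomialEdgeIdeal K G).minimalPrimes, P.height = ((n - 1 : ℕ) : ℕ∞) := by
      intro P hP
      have := hu P hP Q hQ
      rw [idealHeight_eq_height, idealHeight_eq_height] at this
      rw [this]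
      refine le_antisymm ?_ hQh
      rw [← hara]
      exact hub Q hQ
    apply le_antisymm
    · exact (iInf₂_le Q hQ).trans (hall Q hQ).le
    · exact le_iInf₂ fun P hP => (hall P hP).ge
  refine ⟨⟨fun hu => ?_, fun h => ?_⟩, fun hu => ⟨hara, hht hu⟩⟩
  · rw [hht hu, hara]
  · have key : ∀ P ∈ (binomialEdgeIdeal K G).minimalPrimes,
        P.height = (ara (binomialEdgeIdeal K G) : ℕ∞) := by
      intro P hP
      refine le_antisymm (hub P hP) ?_
      rw [h, idealHeight_eq_height]
      exact Ideal.height_mono hP.1.2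
    intro P hP P' hP'
    rw [idealHeight_eq_height, idealHeight_eq_height, key P hP, key P' hP']
end
end

section
/- Let K be a field, n a positive integer, R = K[x_1,…,x_{2n}], and let S be a proper subset of {1,…,n} (possibly empty). Let I ⊆ R be the ideal generated by the set { x_i·x_{n+j} − x_j·x_{n+i} : i, j ∈ {1,…,n} ∖ S } together with the set of variables { x_i : i ∈ S } ∪ { x_{n+i} : i ∈ S }. Then the Krull dimension of the quotient ring R/I equals n − card(S) + 1. -/
open MvPolynomial

noncomputable section

theorem aux_dim_integral {A B : Type*} [CommRing A] [CommRing B] (g : A →+* B)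
    (hg : g.IsIntegral) : ringKrullDim B ≤ ringKrullDim A := by
  algebraize [g]
  refine Order.krullDim_le_of_strictMono (PrimeSpectrum.comap (algebraMap A B)) ?_
  intro P Q h
  exact Ideal.IsIntegral.comap_lt_comap (R := A) (I := P.asIdeal) (J := Q.asIdeal) h

theorem aux_dim_alg (K : Type*) [Field K] (D : Type*) [CommRing D] [IsDomain D] [Algebra K D]
    [Algebra.FiniteType K D] (s : Set D) (c : ℕ) (hs : Cardinal.mk s ≤ c)
    (h : Algebra.IsAlgebraic (Algebra.adjoin K s) D) : ringKrullDim D ≤ (c : WithBot ℕ∞) := by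
  obtain ⟨r, g, hinj, hint⟩ := exists_integral_inj_algHom_of_fg K D
  refine (aux_dim_integral g.toRingHom hint).trans ?_
  have h1 := lift_trdeg_le_of_injective g hinj
  have h2 := Algebra.IsAlgebraic.trdeg_le_cardinalMk K s
  rw [MvPolynomial.trdeg_of_isDomain] at h1
  have h3 := h1.trans (Cardinal.lift_le.mpr (h2.trans hs))
  have h4 : r ≤ c := by simpa using h3
  rw [MvPolynomial.ringKrullDim_of_isNoetherianRing, ringKrullDim_eq_zero_of_field]
  simpa using h4

theorem aux_alg_mul {D : Type*} [CommRing D] [IsDomain D] {K : Type*} [Field K] [Algebra K D]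
    (t : Set D) (a b d : D) (ha : a ∈ t) (hb : b ∈ Algebra.adjoin K t) (ha0 : a ≠ 0)
    (h : a * d = b) : IsAlgebraic (Algebra.adjoin K t) d := by
  refine ⟨Polynomial.C ⟨a, Algebra.subset_adjoin ha⟩ * Polynomial.X - Polynomial.C ⟨b, hb⟩, ?_, ?_⟩
  · intro h0
    have := congrArg (fun p => Polynomial.coeff p 1) h0
    simp [Polynomial.coeff_C] at this
    exact ha0 (congrArg Subtype.val this)
  · simp [h]

theorem aux_quot_prime (K : Type*) [Field K] (n : ℕ) (S : Finset (Fin n))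
    (P : Ideal (MvPolynomial (Fin (n + n)) K)) [P.IsPrime]
    (h1 : ∀ i ∉ S, ∀ j ∉ S, edgeBinomial K n i j ∈ P)
    (h2 : ∀ i ∈ S, X (Fin.castAdd n i) ∈ P) (h3 : ∀ i ∈ S, X (Fin.natAdd n i) ∈ P) :
    ringKrullDim (MvPolynomial (Fin (n + n)) K ⧸ P) ≤ ((n - S.card + 1 : ℕ) : WithBot ℕ∞) := by
  classical
  let D := MvPolynomial (Fin (n + n)) K ⧸ P
  let q : MvPolynomial (Fin (n + n)) K →ₐ[K] D := Ideal.Quotient.mkₐ K P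
  have hq : Function.Surjective q := Ideal.Quotient.mkₐ_surjective K P
  let x : Fin n → D := fun i => q (X (Fin.castAdd n i))
  let y : Fin n → D := fun i => q (X (Fin.natAdd n i))
  have hx : ∀ i ∈ S, x i = 0 := fun i hi => Ideal.Quotient.eq_zero_iff_mem.mpr (h2 i hi)
  have hy : ∀ i ∈ S, y i = 0 := fun i hi => Ideal.Quotient.eq_zero_iff_mem.mpr (h3 i hi)
  have hxy : ∀ i ∉ S, ∀ j ∉ S, x i * y j = x j * y i := by
    intro i hi j hj
    have : q (edgeBinomial K n i j) = 0 := Ideal.Quotient.eq_zero_iff_mem.mpr (h1 i hi j hj)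
    rw [edgeBinomial, map_sub, map_mul, map_mul, sub_eq_zero] at this
    exact this
  have htop : Algebra.adjoin K (Set.range fun k => q (X k)) = ⊤ := by
    have : (Set.range fun k => q (X k)) = q '' (Set.range X) := by
      rw [← Set.range_comp]; rfl
    rw [this, ← AlgHom.map_adjoin, MvPolynomial.adjoin_range_X, Algebra.map_top,
      AlgHom.range_eq_top]
    exact hq
  have key : ∀ (a : D) (f : Fin n → D),
      (∀ i, IsAlgebraic (Algebra.adjoin K (insert a (f '' (Sᶜ : Finset (Fin n))))) (x i)) →
      (∀ i, IsAlgebraic (Algebra.adjoin K (insert a (f '' (Sᶜ : Finset (Fin n))))) (y i)) →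
      ringKrullDim D ≤ ((n - S.card + 1 : ℕ) : WithBot ℕ∞) := by
    intro a f hfx hfy
    refine aux_dim_alg K D (insert a (f '' (Sᶜ : Finset (Fin n)))) _ ?_ ⟨fun d => ?_⟩
    · rw [← Finset.coe_image, ← Finset.coe_insert]
      refine (Cardinal.mk_coe_finset (s := insert a (Finset.image f Sᶜ))).le.trans ?_
      norm_cast
      refine (Finset.card_insert_le _ _).trans ?_
      gcongr
      refine Finset.card_image_le.trans ?_
      rw [Finset.card_compl, Fintype.card_fin]
    · refine IsAlgebraic.adjoin_of_forall_isAlgebraic (s := Set.range fun k => q (X k)) ?_ ?_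
      · rintro _ ⟨⟨k, rfl⟩, -⟩
        refine Fin.addCases (fun i => ?_) (fun i => ?_) k
        · exact hfx i
        · exact hfy i
      · exact isAlgebraic_algebraMap
          (⟨d, by rw [htop]; trivial⟩ : Algebra.adjoin K (Set.range fun k => q (X k)))
  have hmem : ∀ (t : Set D) (d : D), d ∈ t → IsAlgebraic (Algebra.adjoin K t) d := fun t d hd =>
    isAlgebraic_algebraMap (⟨d, Algebra.subset_adjoin hd⟩ : Algebra.adjoin K t)
  by_cases hc : ∃ i ∉ S, x i ≠ 0
  · obtain ⟨i, hi, hi0⟩ := hc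
    refine key (y i) x (fun j => ?_) (fun j => ?_)
    · by_cases hj : j ∈ S
      · rw [hx j hj]; exact isAlgebraic_zero
      · exact hmem _ _ (Or.inr ⟨j, by simpa using hj, rfl⟩)
    · by_cases hj : j ∈ S
      · rw [hy j hj]; exact isAlgebraic_zero
      · refine aux_alg_mul _ (x i) (x j * y i) _ (Or.inr ⟨i, by simpa using hi, rfl⟩) ?_ hi0
          (hxy i hi j hj)
        exact mul_mem (Algebra.subset_adjoin (Or.inr ⟨j, by simpa using hj, rfl⟩))
          (Algebra.subset_adjoin (Or.inl rfl))
  · push Not at hc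
    refine key 0 y (fun j => ?_) (fun j => ?_)
    · have : x j = 0 := by
        by_cases hj : j ∈ S
        · exact hx j hj
        · exact hc j hj
      rw [this]; exact isAlgebraic_zero
    · by_cases hj : j ∈ S
      · rw [hy j hj]; exact isAlgebraic_zero
      · exact hmem _ _ (Or.inr ⟨j, by simpa using hj, rfl⟩)

theorem aux_dim_le {R : Type*} [CommRing R] (I : Ideal R) (c : WithBot ℕ∞)
    (h : ∀ P : Ideal R, P.IsPrime → I ≤ P → ringKrullDim (R ⧸ P) ≤ c) :
    ringKrullDim (R ⧸ I) ≤ c := by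
  rw [ringKrullDim_quotient, Order.krullDim_eq_iSup_coheight]
  refine iSup_le fun p => ?_
  rw [Order.coheight_eq_krullDim_Ici]
  refine le_trans ?_ (h p.1.asIdeal p.1.isPrime p.2)
  rw [ringKrullDim_quotient]
  exact Order.krullDim_le_of_strictMono
    (fun q => ⟨q.1.1, (show p.1.asIdeal ≤ q.1.1.asIdeal from q.2)⟩) (fun a b hab => hab)

theorem aux_lower (K : Type*) [Field K] (n : ℕ)
    (S : Finset (Fin n)) (hS : S ≠ Finset.univ)
    (I : Ideal (MvPolynomial (Fin (n + n)) K))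
    (hI : I = Ideal.span
      ({f | ∃ i ∉ S, ∃ j ∉ S, f = edgeBinomial K n i j} ∪
        {f | ∃ i ∈ S, f = X (Fin.castAdd n i)} ∪
        {f | ∃ i ∈ S, f = X (Fin.natAdd n i)})) :
    ((n - S.card + 1 : ℕ) : WithBot ℕ∞) ≤ ringKrullDim (MvPolynomial (Fin (n + n)) K ⧸ I) := by
  classical
  let U := MvPolynomial {i : Fin n // i ∉ S} K
  let u : Fin n → U := fun i => if h : i ∉ S then X ⟨i, h⟩ else 0
  have hu : ∀ i ∈ S, u i = 0 := fun i hi => by simp [u, hi]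
  let φ : MvPolynomial (Fin (n + n)) K →ₐ[K] Polynomial U :=
    aeval (Fin.addCases (fun i => Polynomial.C (u i)) (fun i => Polynomial.X * Polynomial.C (u i)))
  have φx : ∀ i, φ (X (Fin.castAdd n i)) = Polynomial.C (u i) := fun i => by simp [φ]
  have φy : ∀ i, φ (X (Fin.natAdd n i)) = Polynomial.X * Polynomial.C (u i) := fun i => by
    simp only [φ, aeval_X, Fin.addCases_right]
  have hle : I ≤ RingHom.ker φ.rangeRestrict.toRingHom := by
    rw [hI, Ideal.span_le]
    rintro f ((⟨i, hi, j, hj, rfl⟩ | ⟨i, hi, rfl⟩) | ⟨i, hi, rfl⟩) <;>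
      refine Subtype.ext ?_
    · change φ _ = 0
      rw [edgeBinomial, map_sub, map_mul, map_mul, φx, φx, φy, φy]; ring
    · change φ _ = 0
      rw [φx, hu i hi, map_zero]
    · change φ _ = 0
      rw [φy, hu i hi, map_zero, mul_zero]
  have hsurj : Function.Surjective φ.rangeRestrict.toRingHom := φ.rangeRestrict_surjective
  have s1 : ringKrullDim φ.range ≤ ringKrullDim (MvPolynomial (Fin (n + n)) K ⧸ I) :=
    ringKrullDim_le_of_surjective (Ideal.Quotient.lift I φ.rangeRestrict.toRingHom hle)
      (Ideal.Quotient.lift_surjective_of_surjective I _ hsurj)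
  let ev : Polynomial U →+* U := Polynomial.evalRingHom 0
  let ψ : φ.range →+* U := ev.comp φ.range.val.toRingHom
  have hψ : Function.Surjective ψ := by
    intro p
    refine ⟨⟨φ (rename (fun i => Fin.castAdd n i.1) p), ⟨_, rfl⟩⟩, ?_⟩
    change ev (φ (rename (fun i => Fin.castAdd n i.1) p)) = p
    have : φ (rename (fun i => Fin.castAdd n i.1) p) = Polynomial.C p := by
      induction p using MvPolynomial.induction_on with
      | C a =>
        rw [rename_C]
        simp only [φ, ← MvPolynomial.algebraMap_eq, AlgHom.commutes]
        rfl
      | add p q hp hq => rw [map_add, map_add, hp, hq, map_add]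
      | mul_X p i hp =>
        rw [map_mul, map_mul, hp, rename_X, φx, map_mul]
        simp [u, i.2]
    rw [this]
    simp [ev]
  obtain ⟨i, hi⟩ : ∃ i, i ∉ S := by
    by_contra! h
    exact hS (Finset.eq_univ_iff_forall.mpr h)
  have hui : u i ≠ 0 := by
    simp only [u, hi, not_false_eq_true, dite_true]
    exact MvPolynomial.X_ne_zero _
  have s2 := ringKrullDim_succ_le_of_surjective ψ hψ
    (r := φ.rangeRestrict (X (Fin.natAdd n i))) (by
      rw [mem_nonZeroDivisors_iff_ne_zero]
      intro h
      have := congrArg Subtype.val h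
      change φ _ = 0 at this
      rw [φy] at this
      simp [hui] at this) (by
      change ev (φ _) = 0
      rw [φy]; simp [ev])
  refine le_trans ?_ (s2.trans s1)
  rw [MvPolynomial.ringKrullDim_of_isNoetherianRing, ringKrullDim_eq_zero_of_field]
  have : Nat.card {i : Fin n // i ∉ S} = n - S.card := by
    rw [Nat.card_eq_fintype_card, Fintype.card_subtype_compl]; simp
  rw [this]
  simp

theorem stmt_17 (K : Type*) [Field K] (n : ℕ) (hn : 0 < n)
    (S : Finset (Fin n)) (hS : S ≠ Finset.univ)
    (I : Ideal (MvPolynomial (Fin (n + n)) K))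
    (hI : I = Ideal.span
      ({f | ∃ i ∉ S, ∃ j ∉ S, f = edgeBinomial K n i j} ∪
        {f | ∃ i ∈ S, f = X (Fin.castAdd n i)} ∪
        {f | ∃ i ∈ S, f = X (Fin.natAdd n i)})) :
    ringKrullDim (MvPolynomial (Fin (n + n)) K ⧸ I) = ((n - S.card + 1 : ℕ) : WithBot ℕ∞) := by
  refine le_antisymm (aux_dim_le I _ fun P hP hIP => ?_) (aux_lower K n S hS I hI)
  rw [hI, Ideal.span_le] at hIP
  exact aux_quot_prime K n S P
    (fun i hi j hj => hIP (Or.inl (Or.inl ⟨i, hi, j, hj, rfl⟩)))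
    (fun i hi => hIP (Or.inl (Or.inr ⟨i, hi, rfl⟩)))
    (fun i hi => hIP (Or.inr ⟨i, hi, rfl⟩))
end
end

section
/- Let G be the graph on the vertex set {1,…,5} with edge set { {1,2}, {2,3}, {1,3}, {2,4}, {4,5}, {3,5} }, and let R = K[x_1,…,x_{10}] with f_{ij} = x_i·x_{5+j} − x_j·x_{5+i}. Then rad(J_G) equals the radical of the ideal generated by the five polynomials f_{12}, f_{23}, f_{13} + f_{24}, f_{35}, f_{45}, and ara(J_G) = 5. -/
open MvPolynomial

noncomputable section

/-- Substitute zero for the first `k` variables. -/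
def zeroFirst (K : Type*) [Field K] (k : ℕ) :
    MvPolynomial (Fin 5) K →ₐ[K] MvPolynomial (Fin 5) K :=
  aeval (fun i : Fin 5 => if i.val < k then 0 else X i)

/-- The kernel of `zeroFirst`. -/
def kerFirst (K : Type*) [Field K] (k : ℕ) : Ideal (MvPolynomial (Fin 5) K) :=
  RingHom.ker (zeroFirst K k)

instance kerFirst_prime (K : Type*) [Field K] (k : ℕ) : (kerFirst K k).IsPrime :=
  RingHom.ker_isPrime _

theorem X_mem_kerFirst (K : Type*) [Field K] (k : ℕ) (i : Fin 5) :
    (X i : MvPolynomial (Fin 5) K) ∈ kerFirst K k ↔ i.val < k := by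
  rw [kerFirst, RingHom.mem_ker]
  simp [zeroFirst]

theorem kerFirst_lt (K : Type*) [Field K] (k : ℕ) (hk : k < 5) :
    kerFirst K k < kerFirst K (k + 1) := by
  refine lt_of_le_of_ne ?_ ?_
  · intro p hp
    have hc : (zeroFirst K (k + 1)).comp (zeroFirst K k) = zeroFirst K (k + 1) := by
      apply MvPolynomial.algHom_ext
      intro i
      by_cases h : i.val < k
      · have h2 : i.val < k + 1 := by omega
        simp only [zeroFirst, AlgHom.comp_apply, aeval_X, if_pos h, if_pos h2, map_zero]
      · simp [zeroFirst, h]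
    have hp' : zeroFirst K k p = 0 := hp
    change zeroFirst K (k + 1) p = 0
    rw [← hc, AlgHom.comp_apply, hp', map_zero]
  · intro h
    have h1 := (X_mem_kerFirst K (k + 1) ⟨k, hk⟩).2 (by simp)
    rw [← h, X_mem_kerFirst] at h1
    simp at h1

theorem kerFirst_height (K : Type*) [Field K] (k : ℕ) (hk : k ≤ 5) :
    (k : ℕ∞) ≤ (kerFirst K k).height := by
  induction k with
  | zero => simp
  | succ k ih =>
    have h := Ideal.height_add_one_le_of_lt_of_isPrime (kerFirst_lt K k (by omega))
    refine le_trans ?_ h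
    push_cast
    gcongr
    exact ih (by omega)

theorem kerFirst_le (K : Type*) [Field K] (Q : Ideal (MvPolynomial (Fin 5) K))
    (h : ∀ i, X i ∈ Q) : kerFirst K 5 ≤ Q := by
  intro p hp
  have hc : (Ideal.Quotient.mkₐ K Q).comp (zeroFirst K 5) = Ideal.Quotient.mkₐ K Q := by
    apply MvPolynomial.algHom_ext
    intro i
    have := Ideal.Quotient.eq_zero_iff_mem.2 (h i)
    simp [zeroFirst, this]
  have hp' : zeroFirst K 5 p = 0 := hp
  have h3 : Ideal.Quotient.mkₐ K Q p = 0 := by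
    rw [← hc, AlgHom.comp_apply, hp', map_zero]
  exact Ideal.Quotient.eq_zero_iff_mem.1 h3

/-- The slice. -/
def slice (K : Type*) [Field K] :
    MvPolynomial (Fin (5 + 5)) K →ₐ[K] MvPolynomial (Fin 5) K :=
  aeval (Fin.append ![1, X 0, X 2, X 4, 0] ![0, X 1, X 3, 1, 1])

theorem slice_edge (K : Type*) [Field K] (p q : Fin 5) :
    slice K (edgeBinomial K 5 p q) =
      (![1, X 0, X 2, X 4, 0] : Fin 5 → MvPolynomial (Fin 5) K) p * ![0, X 1, X 3, 1, 1] q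
      - (![1, X 0, X 2, X 4, 0] : Fin 5 → MvPolynomial (Fin 5) K) q * ![0, X 1, X 3, 1, 1] p := by
  simp only [slice, edgeBinomial, map_sub, map_mul, aeval_X, Fin.append_left, Fin.append_right]

theorem stmt_18 (K : Type*) [Field K] (G : SimpleGraph (Fin 5))
    (hadj : ∀ a b : Fin 5, G.Adj a b ↔ s(a, b) ∈
      ({s(0, 1), s(1, 2), s(0, 2), s(1, 3), s(3, 4), s(2, 4)} : Set (Sym2 (Fin 5)))) :
    (binomialEdgeIdeal K G).radical =
      (Ideal.span {edgeBinomial K 5 0 1, edgeBinomial K 5 1 2,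
        edgeBinomial K 5 0 2 + edgeBinomial K 5 1 3,
        edgeBinomial K 5 2 4, edgeBinomial K 5 3 4}).radical ∧
    ara (binomialEdgeIdeal K G) = 5 := by
  have hJ : binomialEdgeIdeal K G = Ideal.span {edgeBinomial K 5 0 1, edgeBinomial K 5 1 2,
      edgeBinomial K 5 0 2, edgeBinomial K 5 1 3, edgeBinomial K 5 3 4, edgeBinomial K 5 2 4} := by
    unfold binomialEdgeIdeal
    congr 1
    ext f
    simp only [Set.mem_ofPred_eq, Set.mem_insert_iff, Set.mem_singleton_iff, hadj]
    constructor
    · rintro ⟨p, q, hpq, h, rfl⟩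
      simp only [Sym2.eq_iff] at h
      rcases h with h | h | h | h | h | h <;> rcases h with ⟨rfl, rfl⟩ | ⟨rfl, rfl⟩ <;>
        first
        | (exact absurd hpq (by decide))
        | simp
    · rintro (rfl | rfl | rfl | rfl | rfl | rfl)
      · exact ⟨0, 1, by decide, by simp, rfl⟩
      · exact ⟨1, 2, by decide, by simp, rfl⟩
      · exact ⟨0, 2, by decide, by simp, rfl⟩
      · exact ⟨1, 3, by decide, by simp, rfl⟩
      · exact ⟨3, 4, by decide, by simp, rfl⟩
      · exact ⟨2, 4, by decide, by simp, rfl⟩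
  set J := binomialEdgeIdeal K G with hJdef
  set I := (Ideal.span {edgeBinomial K 5 0 1, edgeBinomial K 5 1 2,
        edgeBinomial K 5 0 2 + edgeBinomial K 5 1 3,
        edgeBinomial K 5 2 4, edgeBinomial K 5 3 4}) with hI
  have m01 : edgeBinomial K 5 0 1 ∈ J := hJ ▸ Ideal.subset_span (by simp)
  have m12 : edgeBinomial K 5 1 2 ∈ J := hJ ▸ Ideal.subset_span (by simp)
  have m02 : edgeBinomial K 5 0 2 ∈ J := hJ ▸ Ideal.subset_span (by simp)
  have m13 : edgeBinomial K 5 1 3 ∈ J := hJ ▸ Ideal.subset_span (by simp)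
  have m34 : edgeBinomial K 5 3 4 ∈ J := hJ ▸ Ideal.subset_span (by simp)
  have m24 : edgeBinomial K 5 2 4 ∈ J := hJ ▸ Ideal.subset_span (by simp)
  have i01 : edgeBinomial K 5 0 1 ∈ I := Ideal.subset_span (by simp)
  have i12 : edgeBinomial K 5 1 2 ∈ I := Ideal.subset_span (by simp)
  have ig : edgeBinomial K 5 0 2 + edgeBinomial K 5 1 3 ∈ I := Ideal.subset_span (by simp)
  have i34 : edgeBinomial K 5 3 4 ∈ I := Ideal.subset_span (by simp)
  have i24 : edgeBinomial K 5 2 4 ∈ I := Ideal.subset_span (by simp)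
  have hIJ : I ≤ J := by
    rw [hI, Ideal.span_le]
    rintro f (rfl | rfl | rfl | rfl | rfl)
    exacts [m01, m12, J.add_mem m02 m13, m24, m34]
  have i02 : edgeBinomial K 5 0 2 ∈ I.radical := by
    refine ⟨2, ?_⟩
    have e : edgeBinomial K 5 0 2 ^ 2 =
        edgeBinomial K 5 0 2 * (edgeBinomial K 5 0 2 + edgeBinomial K 5 1 3)
        - (edgeBinomial K 5 2 3 * edgeBinomial K 5 0 1
          + edgeBinomial K 5 0 3 * edgeBinomial K 5 1 2) := by
      simp only [edgeBinomial]; ring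
    rw [e]
    exact I.sub_mem (I.mul_mem_left _ ig) (I.add_mem (I.mul_mem_left _ i01) (I.mul_mem_left _ i12))
  have i13 : edgeBinomial K 5 1 3 ∈ I.radical := by
    have := I.radical.sub_mem (Ideal.le_radical ig) i02
    simpa using this
  have hrad : J.radical = I.radical := by
    apply le_antisymm
    · apply Ideal.radical_le_radical_iff.2
      rw [hJ, Ideal.span_le]
      rintro f (rfl | rfl | rfl | rfl | rfl | rfl)
      exacts [Ideal.le_radical i01, Ideal.le_radical i12, i02, i13, Ideal.le_radical i34,
        Ideal.le_radical i24]
    · exact Ideal.radical_mono hIJ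
  refine ⟨hrad, ?_⟩
  have h5 : (5 : ℕ) ∈ {s | ∃ F : Fin s → MvPolynomial (Fin (5 + 5)) K,
      (∀ i, F i ∈ J) ∧ (Ideal.span (Set.range F)).radical = J.radical} := by
    refine ⟨![edgeBinomial K 5 0 1, edgeBinomial K 5 1 2,
        edgeBinomial K 5 0 2 + edgeBinomial K 5 1 3,
        edgeBinomial K 5 2 4, edgeBinomial K 5 3 4], ?_, ?_⟩
    · intro i
      fin_cases i
      exacts [m01, m12, J.add_mem m02 m13, m24, m34]
    · rw [hrad, hI]
      congr 2
      ext f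
      simp
      tauto
  apply le_antisymm
  · exact Nat.sInf_le h5
  · refine le_csInf ⟨5, h5⟩ ?_
    rintro s ⟨F, hF, hFr⟩
    have hJm : J ≤ (kerFirst K 5).comap (slice K) := by
      have hx : ∀ i : Fin 5, (X i : MvPolynomial (Fin 5) K) ∈ kerFirst K 5 :=
        fun i => (X_mem_kerFirst K 5 i).2 i.2
      have e : ∀ a b : MvPolynomial (Fin 5) K, ∀ i j : Fin 5,
          a * X i - b * X j ∈ kerFirst K 5 := fun a b i j =>
        Ideal.sub_mem _ (Ideal.mul_mem_left _ _ (hx i)) (Ideal.mul_mem_left _ _ (hx j))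
      rw [hJ, Ideal.span_le]
      rintro f (rfl | rfl | rfl | rfl | rfl | rfl) <;>
        rw [SetLike.mem_coe, Ideal.mem_comap, slice_edge]
      · convert e 1 0 1 0 using 1; simp
      · convert e (X 0) (X 2) 3 1 using 1; simp
      · convert e 1 0 3 0 using 1; simp
      · convert e 1 (X 4) 0 1 using 1; simp
      · convert e 1 0 4 0 using 1; simp
      · convert e 1 0 2 0 using 1; simp
    have hmin : kerFirst K 5 ∈ (Ideal.span (Set.range fun i => slice K (F i))).minimalPrimes := by
      refine ⟨⟨inferInstance, ?_⟩, ?_⟩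
      · rw [Ideal.span_le]
        rintro _ ⟨i, rfl⟩
        exact hJm (hF i)
      · rintro Q ⟨hQ, hQ2⟩ -
        have hJQ : ∀ f ∈ J, slice K f ∈ Q := by
          intro f hf
          have h1 : f ∈ (Ideal.span (Set.range F)).radical := hFr ▸ Ideal.le_radical hf
          have hp : (Q.comap (slice K)).IsPrime := Ideal.comap_isPrime _ _
          have h2 : (Ideal.span (Set.range F)).radical ≤ Q.comap (slice K) := by
            rw [hp.radical_le_iff, Ideal.span_le]
            rintro _ ⟨i, rfl⟩
            exact hQ2 (Ideal.subset_span ⟨i, rfl⟩)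
          exact h2 h1
        have q1 : X 1 ∈ Q := by simpa [slice_edge] using hJQ _ m01
        have q3 : X 3 ∈ Q := by simpa [slice_edge] using hJQ _ m02
        have q4 : X 4 ∈ Q := by simpa [slice_edge] using hJQ _ m34
        have q2 : X 2 ∈ Q := by simpa [slice_edge] using hJQ _ m24
        have q0 : X 0 ∈ Q := by
          have h := Q.add_mem (hJQ _ m13) (Q.mul_mem_right (X 1) q4)
          simpa [slice_edge] using h
        apply kerFirst_le
        intro i
        fin_cases i
        exacts [q0, q1, q2, q3, q4]
    have h1 := Ideal.height_le_card_of_mem_minimalPrimes_span (Set.finite_range _) hmin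
    have h2 := (kerFirst_height K 5 le_rfl).trans h1
    have h3 : (Set.range fun i => slice K (F i)).ncard ≤ s := by
      rw [← Set.image_univ]
      refine (Set.ncard_image_le Set.finite_univ).trans ?_
      simp [Set.ncard_univ]
    exact le_trans (by exact_mod_cast h2) h3
end
end
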